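/- Let ℓ ≤ m ≤ n. Then the set { ∂_{ω_0[ℓ,m]}(x_ℓ^{a_ℓ} ⋯ x_m^{a_m}) : n−ℓ ≥ a_ℓ > a_{ℓ+1} > ⋯ > a_m ≥ 0, a_i ≤ n−i } is a basis of P_n^{S_{[ℓ,m]} × S_{[m+1,n]}} as a module over P_n^{S_{[ℓ,n]}}, where ∂_{ω_0[ℓ,m]} is the Demazure operator of the longest element of the subgroup S_{[ℓ,m]} generated by s_ℓ,…,s_{m-1}. -/

import Mathlib

open MvPolynomial

/-- `IsDemazure D`: `D i` is the Demazure operator `∂_{i+1}` (zero-based index `i`),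
characterized by `D i P * (x_{i+2} - x_{i+1}) = P - s_{i+1}(P)`. -/
def IsDemazure {K : Type} [Field K] {n : ℕ}
    (D : Fin (n - 1) → MvPolynomial (Fin n) K → MvPolynomial (Fin n) K) : Prop :=
  ∀ (i : Fin (n - 1)) (P : MvPolynomial (Fin n) K),
    D i P * (X (⟨i.val + 1, by have := i.isLt; omega⟩ : Fin n) -
        X (⟨i.val, by have := i.isLt; omega⟩ : Fin n)) =
      P - rename (Equiv.swap (⟨i.val, by have := i.isLt; omega⟩ : Fin n)
        (⟨i.val + 1, by have := i.isLt; omega⟩ : Fin n)) P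

/-- The product of the simple transpositions `s_{i+1}` along a word `L`. -/
def wordProd {n : ℕ} (L : List (Fin (n - 1))) : Equiv.Perm (Fin n) :=
  (L.map (fun i => Equiv.swap (⟨i.val, by have := i.isLt; omega⟩ : Fin n)
    (⟨i.val + 1, by have := i.isLt; omega⟩ : Fin n))).prod

/-- The number of inversions of a permutation, i.e. its Coxeter length. -/
def invCount {n : ℕ} (σ : Equiv.Perm (Fin n)) : ℕ :=
  (Finset.univ.filter (fun p : Fin n × Fin n => p.1 < p.2 ∧ σ p.2 < σ p.1)).card

/-- The subalgebra of polynomials invariant under `S_{[ℓ,n]}`, the subgroup of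
permutations fixing `x_1, …, x_{ℓ-1}` (one-based). -/
noncomputable def intervalInv (K : Type) [Field K] (n ℓ : ℕ) :
    Subalgebra K (MvPolynomial (Fin n) K) where
  carrier := {P | ∀ σ : Equiv.Perm (Fin n),
    (∀ i : Fin n, i.val + 1 < ℓ → σ i = i) → rename σ P = P}
  mul_mem' := fun {a b} ha hb σ hσ => by
    rw [map_mul, ha σ hσ, hb σ hσ]
  add_mem' := fun {a b} ha hb σ hσ => by
    rw [map_add, ha σ hσ, hb σ hσ]
  algebraMap_mem' := fun c σ hσ => by
    simp [algebraMap_eq, rename_C]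

section Invariants

variable {σ K : Type} [Field K]

/-- Polynomials invariant under all permutations of the variables moving only elements of `S`. -/
noncomputable def symmSubalgebra (K : Type) [Field K] (S : Finset σ) :
    Subalgebra K (MvPolynomial σ K) where
  carrier := {P | ∀ w : Equiv.Perm σ, (∀ i, i ∉ S → w i = i) → rename w P = P}
  mul_mem' := fun {a b} ha hb w hw => by rw [map_mul, ha w hw, hb w hw]
  add_mem' := fun {a b} ha hb w hw => by rw [map_add, ha w hw, hb w hw]
  algebraMap_mem' := fun c w hw => by simp [algebraMap_eq]

theorem mem_symmSubalgebra {S : Finset σ} {P : MvPolynomial σ K} :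
    P ∈ symmSubalgebra K S ↔
      ∀ w : Equiv.Perm σ, (∀ i, i ∉ S → w i = i) → rename w P = P := Iff.rfl

theorem X_sub_X_dvd_sub_aeval (s t : σ) (g : σ → MvPolynomial σ K)
    (hg : ∀ i, (X s - X t : MvPolynomial σ K) ∣ X i - g i) (p : MvPolynomial σ K) :
    (X s - X t : MvPolynomial σ K) ∣ p - aeval g p := by
  induction p using MvPolynomial.induction_on with
  | C a => simp [algebraMap_eq]
  | add p q hp hq =>
    rw [map_add, add_sub_add_comm]
    exact dvd_add hp hq
  | mul_X p i hp =>
    have : p * X i - aeval g (p * X i) = (p - aeval g p) * X i + aeval g p * (X i - g i) := by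
      rw [map_mul, aeval_X]; ring
    rw [this]
    exact dvd_add (hp.mul_right _) ((hg i).mul_left _)

variable [DecidableEq σ]

theorem X_sub_X_dvd_sub_rename_swap (s t : σ) (p : MvPolynomial σ K) :
    (X s - X t : MvPolynomial σ K) ∣ p - rename (Equiv.swap s t) p := by
  rw [rename_eq_aeval]
  refine X_sub_X_dvd_sub_aeval s t _ (fun i => ?_) p
  by_cases h1 : i = s
  · subst h1; simp
  by_cases h2 : i = t
  · subst h2
    simp only [Function.comp, Equiv.swap_apply_right]
    exact ⟨-1, by ring⟩
  · simp [Function.comp, Equiv.swap_apply_of_ne_of_ne h1 h2]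

theorem X_sub_X_dvd_iff (s t : σ) (p : MvPolynomial σ K) :
    (X s - X t : MvPolynomial σ K) ∣ p ↔
      aeval (fun i => if i = s then X t else (X i : MvPolynomial σ K)) p = 0 := by
  constructor
  · rintro ⟨q, rfl⟩
    rw [map_mul, map_sub, aeval_X, aeval_X]
    by_cases h : t = s <;> simp [h]
  · intro h
    have := X_sub_X_dvd_sub_aeval (K := K) s t
      (fun i => if i = s then X t else (X i : MvPolynomial σ K)) (fun i => ?_) p
    · rwa [h, sub_zero] at this
    · by_cases h : i = s <;> simp [h]

theorem X_sub_X_prime {s t : σ} (h : s ≠ t) : Prime (X s - X t : MvPolynomial σ K) := by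
  refine ⟨sub_ne_zero.2 fun e => h (X_injective e), fun hu => ?_, fun a b hab => ?_⟩
  · have := (X_sub_X_dvd_iff (K := K) s t 1).1 hu.dvd
    simp at this
  · rw [X_sub_X_dvd_iff, map_mul, mul_eq_zero] at hab
    simpa only [X_sub_X_dvd_iff] using hab

theorem exists_interpolant (f : σ → MvPolynomial σ K) (S : Finset σ)
    (h : ∀ s ∈ S, ∀ t ∈ S, (X s - X t : MvPolynomial σ K) ∣ f s - f t) :
    ∃ G : Polynomial (MvPolynomial σ K), G.degree < S.card ∧
      ∀ s ∈ S, G.eval (X s) = f s := by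
  induction S using Finset.induction_on with
  | empty => exact ⟨0, by simp [Polynomial.degree_zero], by simp⟩
  | insert r S hr ih =>
    obtain ⟨G, hG, hGe⟩ := ih fun s hs t ht =>
      h s (Finset.mem_insert_of_mem hs) t (Finset.mem_insert_of_mem ht)
    have hdvd : (∏ s ∈ S, (X r - X s : MvPolynomial σ K)) ∣ f r - G.eval (X r) := by
      refine Finset.prod_dvd_of_isRelPrime (fun s hs t ht hst => ?_) fun s hs => ?_
      · have hs' : r ≠ s := fun e => hr (e ▸ hs)
        rw [Function.onFun, (X_sub_X_prime hs').irreducible.isRelPrime_iff_not_dvd,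
          X_sub_X_dvd_iff]
        have ht' : t ≠ r := fun e => hr (e ▸ ht)
        simp only [map_sub, aeval_X, if_true, if_neg ht']
        exact sub_ne_zero.2 fun e => hst (X_injective e)
      · have h1 := h r (Finset.mem_insert_self _ _) s (Finset.mem_insert_of_mem hs)
        have h2 : (X r - X s : MvPolynomial σ K) ∣ G.eval (X r) - G.eval (X s) :=
          Polynomial.sub_dvd_eval_sub _ _ _
        rw [hGe s hs] at h2
        simpa using dvd_sub h1 h2
    obtain ⟨g, hg⟩ := hdvd
    refine ⟨G + Polynomial.C g * ∏ s ∈ S, (Polynomial.X - Polynomial.C (X s)), ?_, ?_⟩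
    · rw [Finset.card_insert_of_notMem hr]
      refine (Polynomial.degree_add_le _ _).trans_lt (max_lt (hG.trans ?_) ?_)
      · exact_mod_cast Nat.lt_succ_self _
      · refine (Polynomial.degree_mul_le _ _).trans_lt
          ((add_le_add_left Polynomial.degree_C_le _).trans_lt ?_)
        rw [zero_add, Polynomial.degree_prod]
        simp only [Polynomial.degree_X_sub_C, Finset.sum_const, nsmul_eq_mul, mul_one]
        exact_mod_cast Nat.lt_succ_self _
    · intro s hs
      rw [Polynomial.eval_add, Polynomial.eval_mul, Polynomial.eval_prod, Polynomial.eval_C]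
      simp only [Polynomial.eval_sub, Polynomial.eval_X, Polynomial.eval_C]
      rcases Finset.mem_insert.1 hs with rfl | hs
      · rw [mul_comm, ← hg]; ring
      · rw [Finset.prod_eq_zero hs (sub_self _), mul_zero, add_zero, hGe s hs]

/-- Adjoining one variable: invariants of `S \ {i}` are spanned over the invariants of `S`
by the powers of `X i` with exponent less than the cardinality of `S`. -/
theorem exists_sum_pow_of_mem_erase {S : Finset σ} {i : σ} (hi : i ∈ S)
    {f : MvPolynomial σ K} (hf : f ∈ symmSubalgebra K (S.erase i)) :
    ∃ g : ℕ → MvPolynomial σ K, (∀ j, g j ∈ symmSubalgebra K S) ∧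
      f = ∑ j ∈ Finset.range S.card, g j * X i ^ j := by
  have key : ∀ u : Equiv.Perm σ, (∀ j, j ∉ S → u j = j) →
      rename u f = rename (Equiv.swap i (u i)) f := by
    intro u hu
    have hui : u i ∈ S := by
      by_contra hc
      exact hc ((u.injective (hu _ hc)).symm ▸ hi)
    have h1 := hf (Equiv.swap i (u i) * u) fun j hj => by
      rw [Finset.mem_erase, not_and_or, not_not] at hj
      rcases hj with rfl | hj
      · simp
      · rw [Equiv.Perm.mul_apply, hu j hj, Equiv.swap_apply_of_ne_of_ne]
        · rintro rfl; exact hj hi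
        · rintro rfl; exact hj hui
    nth_rewrite 2 [← h1]
    rw [rename_rename, ← Equiv.Perm.coe_mul, ← mul_assoc, Equiv.swap_mul_self, one_mul]
  have swap_off : ∀ s ∈ S, ∀ t ∈ S, ∀ j, j ∉ S → Equiv.swap s t j = j := by
    intro s hs t ht j hj
    refine Equiv.swap_apply_of_ne_of_ne ?_ ?_
    · rintro rfl; exact hj hs
    · rintro rfl; exact hj ht
  obtain ⟨G, hG, hGe⟩ := exists_interpolant (fun s => rename (Equiv.swap i s) f) S
    fun s hs t ht => by
      have h1 := key (Equiv.swap s t * Equiv.swap i s) fun j hj => by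
        rw [Equiv.Perm.mul_apply, swap_off i hi s hs j hj, swap_off s hs t ht j hj]
      rw [Equiv.Perm.mul_apply, Equiv.swap_apply_left, Equiv.swap_apply_left] at h1
      rw [← h1, Equiv.Perm.coe_mul, ← rename_rename]
      exact X_sub_X_dvd_sub_rename_swap s t _
  have hcard : G.natDegree < S.card := by
    rcases eq_or_ne G 0 with rfl | h0
    · simpa using Finset.card_pos.2 ⟨i, hi⟩
    · exact (Polynomial.natDegree_lt_iff_degree_lt h0).2 hG
  refine ⟨G.coeff, fun j w hw => ?_, ?_⟩
  · have hmap : G.map (rename w : MvPolynomial σ K →ₐ[K] MvPolynomial σ K).toRingHom = G := by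
      refine Polynomial.eq_of_degrees_lt_of_eval_index_eq
        (v := fun s : σ => (X s : MvPolynomial σ K)) S
        (fun s _ t _ e => X_injective e) (Polynomial.degree_map_le.trans_lt hG) hG fun s hs => ?_
      obtain ⟨s', rfl⟩ := w.surjective s
      have hs' : s' ∈ S := by
        by_contra hc
        exact hc (hw _ hc ▸ hs)
      have h2 := key (w * Equiv.swap i s') fun j hj => by
        rw [Equiv.Perm.mul_apply, swap_off i hi s' hs' j hj, hw j hj]
      rw [Equiv.Perm.mul_apply, Equiv.swap_apply_left, Equiv.Perm.coe_mul, ← rename_rename] at h2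
      have h3 : (X (w s') : MvPolynomial σ K) =
          (rename w : MvPolynomial σ K →ₐ[K] MvPolynomial σ K).toRingHom (X s') := by simp
      rw [hGe _ hs, ← h2, ← hGe s' hs', h3, Polynomial.eval_map_apply]
      rfl
    have := congrArg (fun Q => Polynomial.coeff Q j) hmap
    simpa [Polynomial.coeff_map] using this
  · rw [← Polynomial.eval_eq_sum_range' hcard, hGe i hi]
    simp

theorem mem_span_staircase {S : Finset σ} {k : ℕ} (e : Fin k → σ) (he : Function.Injective e)
    (heS : ∀ t, e t ∈ S) {f : MvPolynomial σ K}
    (hf : f ∈ symmSubalgebra K (S \ Finset.univ.image e)) :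
    f ∈ Submodule.span (symmSubalgebra K S)
      {p | ∃ b : Fin k → ℕ, (∀ t, b t + t.val < S.card) ∧ p = ∏ t, X (e t) ^ b t} := by
  induction k generalizing f with
  | zero =>
    have hf' : f ∈ symmSubalgebra K S := by simpa using hf
    have : f = (⟨f, hf'⟩ : symmSubalgebra K S) • (1 : MvPolynomial σ K) := by
      rw [Algebra.smul_def, mul_one]; rfl
    rw [this]
    refine Submodule.smul_mem _ _ (Submodule.subset_span ⟨Fin.elim0, fun t => t.elim0, by simp⟩)
  | succ k ih =>
    set e' : Fin k → σ := fun t => e t.castSucc with he'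
    have he'i : Function.Injective e' := he.comp (Fin.castSucc_injective k)
    set S' := S \ Finset.univ.image e' with hS'
    have hl : e (Fin.last k) ∈ S' := by
      simp only [hS', Finset.mem_sdiff, heS, true_and, Finset.mem_image,
        Finset.mem_univ, not_exists]
      intro t ht
      exact (Fin.castSucc_lt_last t).ne (he ht)
    have hE : S \ Finset.univ.image e = S'.erase (e (Fin.last k)) := by
      ext x
      simp only [hS', Finset.mem_sdiff, Finset.mem_image, Finset.mem_univ, true_and,
        Finset.mem_erase, not_exists, Fin.forall_fin_succ', he', ne_eq]
      tauto
    rw [hE] at hf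
    obtain ⟨g, hg, rfl⟩ := exists_sum_pow_of_mem_erase hl hf
    have hc : S'.card + k = S.card := by
      have := Finset.card_sdiff_add_card_eq_card (s := Finset.univ.image e') (t := S)
        (by intro x hx; obtain ⟨t, -, rfl⟩ := Finset.mem_image.1 hx; exact heS _)
      rwa [Finset.card_image_of_injective _ he'i, Finset.card_univ, Fintype.card_fin] at this
    refine Submodule.sum_mem _ fun j hj => ?_
    rw [Finset.mem_range] at hj
    refine Submodule.span_induction
      (p := fun q _ => q * X (e (Fin.last k)) ^ j ∈ Submodule.span (symmSubalgebra K S)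
      {p | ∃ b : Fin (k + 1) → ℕ, (∀ t, b t + t.val < S.card) ∧ p = ∏ t, X (e t) ^ b t})
      ?_ ?_ ?_ ?_ (ih e' he'i (fun t => heS _) (hg j))
    · rintro _ ⟨b, hb, rfl⟩
      refine Submodule.subset_span ⟨Fin.snoc b j, fun t => ?_, ?_⟩
      · refine Fin.lastCases ?_ (fun t => ?_) t
        · simp; omega
        · simpa using hb t
      · simp [Fin.prod_univ_castSucc, he']
    · simp
    · intro x y _ _ hx hy
      rw [add_mul]; exact add_mem hx hy
    · intro a x _ hx
      rw [smul_mul_assoc]; exact Submodule.smul_mem _ _ hx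

end Invariants

section Demazure

variable {K : Type} [Field K] {n : ℕ}

/-- The simple transposition of the positions `i` and `i + 1`. -/
def adjSwap (i : Fin (n - 1)) : Equiv.Perm (Fin n) :=
  Equiv.swap ⟨i.val, by have := i.isLt; omega⟩ ⟨i.val + 1, by have := i.isLt; omega⟩

/-- The root `X (i + 1) - X i` by which `D i` divides. -/
noncomputable def simpleRoot (K : Type) [Field K] (i : Fin (n - 1)) : MvPolynomial (Fin n) K :=
  X ⟨i.val + 1, by have := i.isLt; omega⟩ - X ⟨i.val, by have := i.isLt; omega⟩

theorem simpleRoot_ne_zero (i : Fin (n - 1)) : simpleRoot K i ≠ 0 :=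
  sub_ne_zero.2 fun e => by simpa using X_injective e

theorem totalDegree_simpleRoot (i : Fin (n - 1)) : (simpleRoot K i).totalDegree = 1 := by
  refine IsHomogeneous.totalDegree ?_ (simpleRoot_ne_zero i)
  exact (isHomogeneous_X _ _).sub (isHomogeneous_X _ _)

variable {D : Fin (n - 1) → MvPolynomial (Fin n) K → MvPolynomial (Fin n) K}

theorem IsDemazure.mul_simpleRoot (hD : IsDemazure D) (i : Fin (n - 1))
    (P : MvPolynomial (Fin n) K) :
    D i P * simpleRoot K i = P - rename (adjSwap i) P := hD i P

theorem IsDemazure.map_add (hD : IsDemazure D) (i : Fin (n - 1)) (P Q : MvPolynomial (Fin n) K) :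
    D i (P + Q) = D i P + D i Q := by
  refine mul_right_cancel₀ (simpleRoot_ne_zero i) ?_
  rw [add_mul, hD.mul_simpleRoot, hD.mul_simpleRoot, hD.mul_simpleRoot, _root_.map_add]
  ring

theorem IsDemazure.map_mul_of_rename_eq (hD : IsDemazure D) (i : Fin (n - 1))
    {g : MvPolynomial (Fin n) K} (hg : rename (adjSwap i) g = g) (P : MvPolynomial (Fin n) K) :
    D i (g * P) = g * D i P := by
  refine mul_right_cancel₀ (simpleRoot_ne_zero i) ?_
  rw [mul_assoc, hD.mul_simpleRoot, hD.mul_simpleRoot, map_mul, hg, mul_sub]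

theorem IsDemazure.totalDegree_add_one_le (hD : IsDemazure D) (i : Fin (n - 1))
    {P : MvPolynomial (Fin n) K} (h : D i P ≠ 0) :
    (D i P).totalDegree + 1 ≤ P.totalDegree := by
  rw [← totalDegree_simpleRoot (K := K) i,
    ← totalDegree_mul_of_isDomain h (simpleRoot_ne_zero i), hD.mul_simpleRoot]
  exact (totalDegree_sub _ _).trans (max_le le_rfl (totalDegree_rename_le _ _))

theorem IsDemazure.map_zero (hD : IsDemazure D) (i : Fin (n - 1)) : D i 0 = 0 := by
  simpa using hD.map_mul_of_rename_eq i (g := 0) (by simp) 0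

theorem IsDemazure.foldr_add (hD : IsDemazure D) (L : List (Fin (n - 1)))
    (P Q : MvPolynomial (Fin n) K) :
    L.foldr D (P + Q) = L.foldr D P + L.foldr D Q := by
  induction L with
  | nil => rfl
  | cons i L ih => rw [List.foldr_cons, ih, hD.map_add]; rfl

theorem IsDemazure.foldr_mul (hD : IsDemazure D) {L : List (Fin (n - 1))}
    {g : MvPolynomial (Fin n) K} (hg : ∀ i ∈ L, rename (adjSwap i) g = g)
    (P : MvPolynomial (Fin n) K) :
    L.foldr D (g * P) = g * L.foldr D P := by
  induction L with
  | nil => rfl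
  | cons i L ih =>
    rw [List.foldr_cons, ih fun j hj => hg j (List.mem_cons_of_mem _ hj),
      hD.map_mul_of_rename_eq i (hg i List.mem_cons_self)]
    rfl

theorem IsDemazure.foldr_zero (hD : IsDemazure D) (L : List (Fin (n - 1))) :
    L.foldr D 0 = 0 := by
  simpa using hD.foldr_mul (L := L) (g := 0) (by simp) 0

theorem IsDemazure.totalDegree_foldr (hD : IsDemazure D) (L : List (Fin (n - 1)))
    {P : MvPolynomial (Fin n) K} (h : L.foldr D P ≠ 0) :
    (L.foldr D P).totalDegree + L.length ≤ P.totalDegree := by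
  induction L with
  | nil => simp
  | cons i L ih =>
    rw [List.foldr_cons] at h ⊢
    have h' : L.foldr D P ≠ 0 := fun e => h (by rw [e, hD.map_zero])
    have := ih h'
    have := hD.totalDegree_add_one_le i h
    simp only [List.length_cons]
    omega

theorem invCount_adjSwap_mul_le (i : Fin (n - 1)) (v : Equiv.Perm (Fin n)) :
    invCount (adjSwap i * v) ≤ invCount v + 1 := by
  unfold invCount
  set p : Fin n × Fin n := (v.symm ⟨i.val, by have := i.isLt; omega⟩,
    v.symm ⟨i.val + 1, by have := i.isLt; omega⟩) with hp
  refine (Finset.card_le_card (t := insert p (Finset.univ.filter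
    fun q : Fin n × Fin n => q.1 < q.2 ∧ v q.2 < v q.1)) ?_).trans (Finset.card_insert_le _ _)
  rintro ⟨a, b⟩ hab
  replace hab : a < b ∧ adjSwap i (v b) < adjSwap i (v a) := (Finset.mem_filter.1 hab).2
  rw [Finset.mem_insert, Finset.mem_filter]
  by_contra hc
  rw [not_or] at hc
  have hne : v a ≠ v b := fun e => hab.1.ne (v.injective e)
  have h1 : v a < v b :=
    lt_of_le_of_ne (not_lt.1 fun e => hc.2 ⟨Finset.mem_univ _, hab.1, e⟩) hne
  have h2 : ¬ (v a = ⟨i.val, by have := i.isLt; omega⟩ ∧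
      v b = ⟨i.val + 1, by have := i.isLt; omega⟩) := fun e => hc.1 (by
    rw [hp, ← e.1, ← e.2, Equiv.symm_apply_apply, Equiv.symm_apply_apply])
  have h3 := hab.2
  simp only [adjSwap, Equiv.swap_apply_def] at h3
  simp only [Fin.ext_iff, Fin.lt_def] at h1 h2 hne h3
  split_ifs at h3 <;> simp at * <;> omega

theorem wordProd_cons (i : Fin (n - 1)) (L : List (Fin (n - 1))) :
    wordProd (i :: L) = adjSwap i * wordProd L := by
  simp [wordProd, adjSwap]

theorem invCount_wordProd_le (L : List (Fin (n - 1))) : invCount (wordProd L) ≤ L.length := by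
  induction L with
  | nil =>
    simp only [wordProd, invCount, List.map_nil, List.prod_nil, Equiv.Perm.one_apply,
      List.length_nil, nonpos_iff_eq_zero, Finset.card_eq_zero, Finset.filter_eq_empty_iff]
    rintro p - ⟨h1, h2⟩
    exact lt_asymm h1 h2
  | cons i L ih =>
    rw [wordProd_cons, List.length_cons]
    exact (invCount_adjSwap_mul_le i _).trans (by omega)

/-- Up to a nonzero denominator, a product of Demazure operators is a combination of
permutations of length at most that of the word, with nonzero leading coefficient
when the word is reduced. -/
theorem IsDemazure.exists_expansion (hD : IsDemazure D) (L : List (Fin (n - 1))) :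
    ∃ d : MvPolynomial (Fin n) K, d ≠ 0 ∧ ∃ c : Equiv.Perm (Fin n) → MvPolynomial (Fin n) K,
      (∀ f, d * L.foldr D f = ∑ v, c v * rename v f) ∧
      (∀ v, c v ≠ 0 → invCount v ≤ L.length) ∧
      (invCount (wordProd L) = L.length → c (wordProd L) ≠ 0) := by
  induction L with
  | nil =>
    refine ⟨1, one_ne_zero, fun v => if v = 1 then 1 else 0, fun f => ?_, fun v hv => ?_, ?_⟩
    · simp
    · have : v = 1 := by by_contra h; simp [h] at hv
      subst this
      exact invCount_wordProd_le []
    · simp [wordProd]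
  | cons i L ih =>
    obtain ⟨d, hd, c, hf, hlen, hred⟩ := ih
    have hinv : adjSwap i * adjSwap i = (1 : Equiv.Perm (Fin n)) := Equiv.swap_mul_self _ _
    have hs : ∀ p : MvPolynomial (Fin n) K, p ≠ 0 → rename (adjSwap i) p ≠ 0 := fun p hp h =>
      hp (rename_injective _ (adjSwap i).injective (by rw [h, _root_.map_zero]))
    refine ⟨d * rename (adjSwap i) d * simpleRoot K i,
      mul_ne_zero (mul_ne_zero hd (hs d hd)) (simpleRoot_ne_zero i),
      fun v => rename (adjSwap i) d * c v - d * rename (adjSwap i) (c (adjSwap i * v)),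
      fun f => ?_, fun v hv => ?_, fun h => ?_⟩
    · have h1 : ∑ v, rename (adjSwap i) (c (adjSwap i * v)) * rename v f =
          rename (adjSwap i) (d * L.foldr D f) := by
        rw [hf, map_sum, ← Equiv.sum_comp (Equiv.mulLeft (adjSwap i))]
        refine Finset.sum_congr rfl fun v _ => ?_
        rw [Equiv.coe_mulLeft, ← mul_assoc, hinv, one_mul, map_mul, rename_rename,
          Equiv.Perm.coe_mul]
      simp only [sub_mul, Finset.sum_sub_distrib, mul_assoc, ← Finset.mul_sum]
      rw [h1, ← hf, List.foldr_cons, mul_comm (simpleRoot K i), hD.mul_simpleRoot, map_mul]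
      ring
    · rw [List.length_cons]
      by_cases h : c v = 0
      · have h' : c (adjSwap i * v) ≠ 0 := fun e => hv (by simp [h, e])
        have h2 := invCount_adjSwap_mul_le i (adjSwap i * v)
        rw [← mul_assoc, hinv, one_mul] at h2
        exact h2.trans (Nat.succ_le_succ (hlen _ h'))
      · exact (hlen v h).trans (Nat.le_succ _)
    · rw [List.length_cons] at h
      have h0 : c (wordProd (i :: L)) = 0 := by
        by_contra e
        have := hlen _ e
        omega
      have hL : invCount (wordProd L) = L.length := by
        have h1 := invCount_adjSwap_mul_le i (wordProd L)
        rw [← wordProd_cons] at h1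
        have := invCount_wordProd_le L
        omega
      have h2 := hred hL
      simp only [h0, mul_zero, zero_sub, ne_eq, neg_eq_zero]
      rw [wordProd_cons, ← mul_assoc, hinv, one_mul]
      exact mul_ne_zero hd (hs _ h2)

theorem IsDemazure.exists_foldr_ne_zero (hD : IsDemazure D) {L : List (Fin (n - 1))}
    (hL : invCount (wordProd L) = L.length) : ∃ f, L.foldr D f ≠ 0 := by
  by_contra! h
  obtain ⟨d, -, c, hf, -, hred⟩ := hD.exists_expansion L
  have hli := (linearIndependent_monoidHom (MvPolynomial (Fin n) K)
    (MvPolynomial (Fin n) K)).comp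
    (fun v : Equiv.Perm (Fin n) =>
      ((rename v : MvPolynomial (Fin n) K →ₐ[K] MvPolynomial (Fin n) K) :
        MvPolynomial (Fin n) K →* MvPolynomial (Fin n) K)) fun v w hvw => by
      ext i
      have := DFunLike.congr_fun hvw (X i)
      simp only [MonoidHom.coe_coe, rename_X] at this
      rw [X_injective this]
  rw [Fintype.linearIndependent_iff] at hli
  refine hred hL (hli c ?_ _)
  funext f
  have := hf f
  rw [h, mul_zero] at this
  simpa using this.symm

end Demazure

section Alternant

variable {σ K : Type} [Field K] {k : ℕ}

/-- The alternant `det (X (e i) ^ b j)`. -/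
noncomputable def alternant (K : Type) [Field K] (e : Fin k → σ) (b : Fin k → ℕ) :
    MvPolynomial σ K :=
  Matrix.det (Matrix.of fun i j => (X (e i) : MvPolynomial σ K) ^ b j)

theorem alternant_comp_left (e : Fin k → σ) (b : Fin k → ℕ) (w : Equiv.Perm (Fin k)) :
    alternant K (e ∘ w) b = (Equiv.Perm.sign w : ℤ) * alternant K e b :=
  Matrix.det_permute w (Matrix.of fun i j => (X (e i) : MvPolynomial σ K) ^ b j)

theorem alternant_comp_right (e : Fin k → σ) (b : Fin k → ℕ) (w : Equiv.Perm (Fin k)) :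
    alternant K e (b ∘ w) = (Equiv.Perm.sign w : ℤ) * alternant K e b :=
  Matrix.det_permute' w (Matrix.of fun i j => (X (e i) : MvPolynomial σ K) ^ b j)

theorem alternant_eq_zero (e : Fin k → σ) {b : Fin k → ℕ} (hb : ¬ Function.Injective b) :
    alternant K e b = 0 := by
  simp only [Function.Injective, not_forall] at hb
  obtain ⟨i, j, hij, hne⟩ := hb
  exact Matrix.det_zero_of_column_eq hne fun t => by simp [hij]

theorem rename_alternant (f : σ → σ) (e : Fin k → σ) (b : Fin k → ℕ) :
    rename f (alternant K e b) = alternant K (f ∘ e) b := by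
  rw [alternant, AlgHom.map_det, alternant]
  congr 1
  ext1 i j
  simp

theorem alternant_rev_ne_zero {e : Fin k → σ} (he : Function.Injective e) :
    alternant K e (fun t => k - 1 - t.val) ≠ 0 := by
  have h : alternant K e (fun t => k - 1 - t.val) =
      alternant K e ((fun t : Fin k => t.val) ∘ Fin.revPerm) := by
    congr 1
    funext t
    simp [Fin.val_rev]
    omega
  have hv : alternant K e (fun t : Fin k => t.val) ≠ 0 :=
    Matrix.det_vandermonde_ne_zero_iff.2 fun i j hij => he (X_injective hij)
  rw [h, alternant_comp_right]
  refine mul_ne_zero ?_ hv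
  rcases Int.units_eq_one_or (Equiv.Perm.sign (Fin.revPerm (n := k))) with h | h <;> simp [h]

/-- The alternating sum over the permutations of the positions in the range of `e`. -/
noncomputable def antisymmetrize [DecidableEq σ] (e : Fin k ↪ σ) (f : MvPolynomial σ K) :
    MvPolynomial σ K :=
  ∑ w : Equiv.Perm (Fin k), Equiv.Perm.sign w • rename (w.viaFintypeEmbedding e) f

theorem antisymmetrize_monomial [DecidableEq σ] (e : Fin k ↪ σ) (b : Fin k → ℕ) :
    antisymmetrize e (∏ t, (X (e t) : MvPolynomial σ K) ^ b t) = alternant K e b := by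
  rw [antisymmetrize, alternant, Matrix.det_apply]
  refine Finset.sum_congr rfl fun w _ => ?_
  simp [Equiv.Perm.viaFintypeEmbedding_apply_image]

theorem antisymmetrize_mul [DecidableEq σ] (e : Fin k ↪ σ) {g : MvPolynomial σ K}
    (hg : g ∈ symmSubalgebra K (Finset.univ.image e)) (f : MvPolynomial σ K) :
    antisymmetrize e (g * f) = g * antisymmetrize e f := by
  rw [antisymmetrize, antisymmetrize, Finset.mul_sum]
  refine Finset.sum_congr rfl fun w _ => ?_
  rw [map_mul, hg _ fun i hi => Equiv.Perm.viaFintypeEmbedding_apply_notMem_range _ _ fun ⟨t, ht⟩ =>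
    hi (Finset.mem_image.2 ⟨t, Finset.mem_univ _, ht⟩), mul_smul_comm]

theorem eq_rev_of_injective_of_le {b : Fin k → ℕ} (hb : Function.Injective b)
    (hle : ∀ t, b t ≤ k - 1 - t.val) (t : Fin k) : b t = k - 1 - t.val := by
  have hk : ∀ t, b t < k := fun t => by have := hle t; have := t.isLt; omega
  have hbij : Function.Bijective fun t => (⟨b t, hk t⟩ : Fin k) :=
    Finite.injective_iff_bijective.1 fun i j h => hb (by simpa using h)
  have h1 : ∑ t, b t = ∑ t : Fin k, t.val := hbij.sum_comp (fun t : Fin k => t.val)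
  have h2 : ∑ t : Fin k, (k - 1 - t.val) = ∑ t : Fin k, t.val := by
    rw [← Equiv.sum_comp Fin.revPerm]
    refine Finset.sum_congr rfl fun t _ => ?_
    simp [Fin.val_rev]
    omega
  exact (Finset.sum_eq_sum_iff_of_le fun t _ => hle t).1 (h1.trans h2.symm) t (Finset.mem_univ _)

theorem sum_rev_val (k : ℕ) : ∑ t : Fin k, (k - 1 - t.val) = k * (k - 1) / 2 := by
  rw [Fin.sum_univ_eq_sum_range fun t => k - 1 - t, Finset.sum_range_reflect (fun t => t),
    Finset.sum_range_id]

theorem sum_lt_of_le_of_ne_rev {b : Fin k → ℕ} (hle : ∀ t, b t ≤ k - 1 - t.val)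
    (hb : b ≠ fun t => k - 1 - t.val) : ∑ t, b t < k * (k - 1) / 2 := by
  rw [← sum_rev_val]
  refine lt_of_le_of_ne (Finset.sum_le_sum fun t _ => hle t) fun h => hb ?_
  funext t
  exact (Finset.sum_eq_sum_iff_of_le fun t _ => hle t).1 h t (Finset.mem_univ _)

theorem totalDegree_prod_X_pow_le (e : Fin k → σ) (b : Fin k → ℕ) :
    (∏ t, (X (e t) : MvPolynomial σ K) ^ b t).totalDegree ≤ ∑ t, b t := by
  refine (totalDegree_finsetProd _ _).trans (Finset.sum_le_sum fun t _ => ?_)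
  exact (totalDegree_pow _ _).trans (by simp)

theorem AlternatingMap.finset_sum_apply {R M N ι κ : Type*} [CommSemiring R] [AddCommMonoid M]
    [AddCommMonoid N] [Module R M] [Module R N] (s : Finset κ) (g : κ → M [⋀^ι]→ₗ[R] N)
    (v : ι → M) : (∑ i ∈ s, g i) v = ∑ i ∈ s, g i v :=
  map_sum (⟨⟨fun h => h v, rfl⟩, fun _ _ => rfl⟩ : (M [⋀^ι]→ₗ[R] N) →+ N) g s

/-- Alternants at all choices of `k` among `N` distinct nodes separate exponent sequences. -/
theorem eq_zero_of_sum_det_pow_eq_zero {F ι : Type} [Field F] {N : ℕ} (hN : N ≠ 0)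
    {x : Fin N → F} (hx : Function.Injective x) (s : Finset ι) (a : ι → Fin k → ℕ)
    (hinj : Function.Injective a) (ha : ∀ i, StrictAnti (a i)) (hlt : ∀ i t, a i t < N)
    (f : ι → F)
    (h : ∀ v : Fin k → Fin N, Function.Injective v →
      ∑ i ∈ s, f i * Matrix.det (Matrix.of fun p q => x (v p) ^ a i q) = 0) :
    ∀ i ∈ s, f i = 0 := by
  classical
  have : Nonempty (Fin N) := ⟨⟨0, Nat.pos_of_ne_zero hN⟩⟩
  let ω : (Fin N → F) [⋀^Fin k]→ₗ[F] F := ∑ i ∈ s, f i •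
    (Matrix.detRowAlternating (R := F) (n := Fin k)).compLinearMap
      (LinearMap.funLeft F F fun t => (⟨a i t, hlt i t⟩ : Fin N))
  have hω : ∀ v, ω v = ∑ i ∈ s, f i *
      Matrix.det (Matrix.of fun p q => v p ⟨a i q, hlt i q⟩) := by
    intro v
    rw [AlternatingMap.finset_sum_apply]
    rfl
  have hli : LinearIndependent F (Matrix.vandermonde x).row :=
    Matrix.linearIndependent_rows_of_det_ne_zero (Matrix.det_vandermonde_ne_zero_iff.2 hx)
  let B := basisOfLinearIndependentOfCardEqFinrank hli (by simp)
  have h0 : ω = 0 := by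
    refine Module.Basis.ext_alternating B fun v hv => ?_
    rw [hω, AlternatingMap.zero_apply, ← h v hv]
    simp [B, Matrix.vandermonde_apply]
  intro i hi
  have h1 := hω fun p => Pi.single ⟨a i p, hlt i p⟩ 1
  rw [h0, AlternatingMap.zero_apply, Finset.sum_eq_single_of_mem i hi] at h1
  · have h2 : (Matrix.of fun p q : Fin k =>
        (Pi.single (⟨a i p, hlt i p⟩ : Fin N) (1 : F) : Fin N → F) ⟨a i q, hlt i q⟩) = 1 := by
      ext p q
      simp only [Matrix.of_apply, Pi.single_apply, Fin.mk.injEq, (ha i).injective.eq_iff,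
        Matrix.one_apply, eq_comm]
    rw [h2, Matrix.det_one, mul_one] at h1
    exact h1.symm
  · intro j _ hji
    have : ∃ p, ∀ q, a j q ≠ a i p := by
      by_contra! hc
      refine hji (hinj ?_)
      have hr : Set.range (a i) ⊆ Set.range (a j) := by
        rintro _ ⟨p, rfl⟩
        exact hc p
      have hcard : (Finset.univ.image (a i)) = Finset.univ.image (a j) := by
        refine Finset.eq_of_subset_of_card_le ?_ ?_
        · rw [← Finset.coe_subset]; simpa using hr
        · rw [Finset.card_image_of_injective _ (ha i).injective,
            Finset.card_image_of_injective _ (ha j).injective]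
      have hr' : Set.range (a j) = Set.range (a i) := by
        have := congrArg (fun s : Finset ℕ => (s : Set ℕ)) hcard
        simpa using this.symm
      have := (StrictMono.range_inj (f := fun t => OrderDual.toDual (a j t))
        (g := fun t => OrderDual.toDual (a i t)) (fun _ _ h => ha j h) (fun _ _ h => ha i h)).1 hr'
      exact this
    obtain ⟨p, hp⟩ := this
    rw [Matrix.det_eq_zero_of_row_eq_zero p fun q => ?_, mul_zero]
    simp only [Matrix.of_apply]
    rw [Pi.single_eq_of_ne]
    simpa using hp q

end Alternant

section Formula

variable {K : Type} [Field K] {n : ℕ}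
  {D : Fin (n - 1) → MvPolynomial (Fin n) K → MvPolynomial (Fin n) K}

/-- The Demazure operator of the longest element is antisymmetrization divided by the Vandermonde
alternant, up to a nonzero constant. -/
theorem IsDemazure.exists_foldr_formula (hD : IsDemazure D) {k : ℕ} (e : Fin k ↪ Fin n)
    {L : List (Fin (n - 1))}
    (hLe : ∀ i ∈ L, ∀ j, j ∉ Finset.univ.image e → adjSwap i j = j)
    (hlen : L.length = k * (k - 1) / 2) (hred : invCount (wordProd L) = L.length) :
    ∃ c : K, c ≠ 0 ∧ ∀ b : Fin k → ℕ,
      alternant K e (fun t => k - 1 - t.val) * L.foldr D (∏ t, X (e t) ^ b t) =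
        C c * alternant K e b := by
  set Δ := alternant K e (fun t => k - 1 - t.val) with hΔ
  set T := L.foldr D (∏ t, X (e t) ^ (k - 1 - t.val)) with hT
  have hT' : T = C (coeff 0 T) := by
    rw [← totalDegree_eq_zero_iff_eq_C]
    by_cases h0 : T = 0
    · simp [h0]
    · have h1 := hD.totalDegree_foldr L h0
      rw [← hT] at h1
      have h2 := totalDegree_prod_X_pow_le (K := K) e (fun t : Fin k => k - 1 - t.val)
      rw [sum_rev_val] at h2
      omega
  have key : ∀ f, Δ * L.foldr D f = C (coeff 0 T) * antisymmetrize e f := by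
    intro f
    have hf := mem_span_staircase (K := K) (S := Finset.univ.image e) e e.injective
      (fun t => Finset.mem_image_of_mem _ (Finset.mem_univ t)) (f := f) fun w hw => by
        have : w = 1 := Equiv.ext fun i => hw i (by simp)
        subst this
        simp
    refine Submodule.span_induction
      (p := fun f _ => Δ * L.foldr D f = C (coeff 0 T) * antisymmetrize e f) ?_ ?_ ?_ ?_ hf
    · rintro _ ⟨b, hb, rfl⟩
      rw [Finset.card_image_of_injective _ e.injective, Finset.card_univ, Fintype.card_fin] at hb
      have hle : ∀ t, b t ≤ k - 1 - t.val := fun t => by have := hb t; omega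
      rw [antisymmetrize_monomial]
      by_cases hbr : b = fun t => k - 1 - t.val
      · subst hbr
        rw [← hT, ← hT', mul_comm]
      · have h1 : L.foldr D (∏ t, X (e t) ^ b t) = 0 := by
          by_contra h0
          have h1 := hD.totalDegree_foldr L h0
          have h2 := totalDegree_prod_X_pow_le (K := K) e b
          have h3 := sum_lt_of_le_of_ne_rev hle hbr
          omega
        rw [h1, alternant_eq_zero e fun hi => hbr (funext (eq_rev_of_injective_of_le hi hle)),
          mul_zero, mul_zero]
    · simp [hD.foldr_zero, antisymmetrize]
    · intro x y _ _ hx hy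
      have h1 : antisymmetrize e (x + y) = antisymmetrize e x + antisymmetrize e y := by
        simp [antisymmetrize, smul_add, Finset.sum_add_distrib]
      rw [hD.foldr_add, h1, mul_add, mul_add, hx, hy]
    · intro a x _ hx
      rw [Algebra.smul_def]
      change Δ * L.foldr D ((a : MvPolynomial (Fin n) K) * x) =
        C (coeff 0 T) * antisymmetrize e ((a : MvPolynomial (Fin n) K) * x)
      rw [hD.foldr_mul fun i hi => a.2 _ (hLe i hi), antisymmetrize_mul e a.2,
        mul_left_comm, hx, mul_left_comm]
  refine ⟨coeff 0 T, fun h0 => ?_, fun b => by rw [key, antisymmetrize_monomial]⟩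
  obtain ⟨f, hf⟩ := hD.exists_foldr_ne_zero hred
  have := key f
  rw [h0, C_0, zero_mul] at this
  exact mul_ne_zero (alternant_rev_ne_zero e.injective) hf this

end Formula

section Interval

variable {K : Type} [Field K]

theorem intervalInv_eq_symmSubalgebra (n ℓ : ℕ) :
    intervalInv K n ℓ = symmSubalgebra K (Finset.univ.filter fun i : Fin n => ℓ ≤ i.val + 1) := by
  ext P
  rw [mem_symmSubalgebra]
  simp only [Finset.mem_filter, Finset.mem_univ, true_and, not_le]
  rfl

theorem exists_perm_apply_eq {α : Type} [DecidableEq α] {k : ℕ} (S : Finset α) (e v : Fin k → α)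
    (he : Function.Injective e) (hv : Function.Injective v) (heS : ∀ t, e t ∈ S)
    (hvS : ∀ t, v t ∈ S) :
    ∃ w : Equiv.Perm α, (∀ i, i ∉ S → w i = i) ∧ ∀ t, w (e t) = v t := by
  have := Equiv.Perm.isMultiplyPretransitive {i // i ∈ S} k
  obtain ⟨g, hg⟩ := this.exists_smul_eq
    (⟨fun t => ⟨e t, heS t⟩, fun a b h => he (by simpa using h)⟩ : Fin k ↪ {i // i ∈ S})
    ⟨fun t => ⟨v t, hvS t⟩, fun a b h => hv (by simpa using h)⟩
  refine ⟨Equiv.Perm.ofSubtype g, fun i hi => Equiv.Perm.ofSubtype_apply_of_not_mem g hi,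
    fun t => ?_⟩
  have h := DFunLike.congr_fun hg t
  rw [Equiv.Perm.ofSubtype_apply_of_mem g (heS t)]
  exact congrArg Subtype.val h

theorem exists_perm_comp_eq {α : Type} {k : ℕ} (e : Fin k ↪ α) (w : Equiv.Perm α)
    (h : ∀ t, w (e t) ∈ Set.range e) : ∃ τ : Equiv.Perm (Fin k), w ∘ e = e ∘ τ := by
  choose f hf using h
  have hinj : Function.Injective f := fun a b hab =>
    e.injective (w.injective (by rw [← hf, ← hf, hab]))
  exact ⟨Equiv.ofBijective f (Finite.injective_iff_bijective.1 hinj), funext fun t => (hf t).symm⟩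

theorem exists_perm_strictAnti {k : ℕ} {b : Fin k → ℕ} (hb : Function.Injective b) :
    ∃ τ : Equiv.Perm (Fin k), StrictAnti (b ∘ τ) := by
  refine ⟨Fin.revPerm.trans (Tuple.sort b), ?_⟩
  have h := (Tuple.monotone_sort b).strictMono_of_injective
    (hb.comp (Tuple.sort b).injective)
  exact fun i j hij => h (Fin.rev_lt_rev.2 hij)

theorem add_val_le_of_strictAnti {k N : ℕ} {a : Fin k → ℕ} (ha : StrictAnti a)
    (hN : ∀ t, a t ≤ N) (t : Fin k) : a t + t.val ≤ N := by
  obtain ⟨t, ht⟩ := t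
  induction t with
  | zero => exact hN _
  | succ t ih =>
    have h1 := ih (by omega)
    have h2 : a ⟨t + 1, ht⟩ < a ⟨t, by omega⟩ := ha (Fin.mk_lt_mk.2 (Nat.lt_succ_self t))
    simp only at h1 ⊢
    omega

theorem rename_eq_of_mul_alternant {σ : Type} {k : ℕ} (e : Fin k ↪ σ) {w : Equiv.Perm σ}
    {τ : Equiv.Perm (Fin k)} (hw : w ∘ e = e ∘ τ) {b : Fin k → ℕ} {c : K} {Q : MvPolynomial σ K}
    (hQ : alternant K e (fun t => k - 1 - t.val) * Q = C c * alternant K e b) :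
    rename w Q = Q := by
  have h := congrArg (rename w) hQ
  rw [map_mul, map_mul, rename_alternant, rename_alternant, hw, alternant_comp_left,
    alternant_comp_left, rename_C, mul_left_comm, ← hQ, mul_assoc] at h
  have hs : (((Equiv.Perm.sign τ : ℤ) : MvPolynomial σ K)) ≠ 0 := by
    rcases Int.units_eq_one_or (Equiv.Perm.sign τ) with h | h <;> simp [h]
  exact mul_left_cancel₀ (alternant_rev_ne_zero e.injective) (mul_left_cancel₀ hs h)

end Interval

/-- Let `1 ≤ ℓ ≤ m ≤ n`.  The family
`∂_{ω₀[ℓ,m]}(x_ℓ^{a_ℓ} ⋯ x_m^{a_m})`, indexed by strictly decreasing sequences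
`a = (a_ℓ > ⋯ > a_m)` with `a_i ≤ n - i`, is a basis of `P_n^{S_{[ℓ,m]} × S_{[m+1,n]}}`
as a module over `P_n^{S_{[ℓ,n]}}`.  Here `∂_{ω₀[ℓ,m]}` is encoded by folding the Demazure
operators `D` along any reduced word `L₀` for the longest element of `S_{[ℓ,m]}`
(entries among `s_ℓ,…,s_{m-1}`, length `(m-ℓ+1)(m-ℓ)/2`, reduced). -/
theorem demazure_interval_basis {K : Type} [Field K] (n ℓ m : ℕ)
    (hℓ : 1 ≤ ℓ) (hm : ℓ ≤ m) (hn : m ≤ n)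
    (D : Fin (n - 1) → MvPolynomial (Fin n) K → MvPolynomial (Fin n) K)
    (hD : IsDemazure D)
    (L₀ : List (Fin (n - 1)))
    (hL₀mem : ∀ j ∈ L₀, ℓ - 1 ≤ j.val ∧ j.val + 2 ≤ m)
    (hL₀len : L₀.length = (m - ℓ + 1) * (m - ℓ) / 2)
    (hL₀red : invCount (wordProd L₀) = L₀.length) :
    LinearIndependent (↥(intervalInv K n ℓ))
      (fun a : {a : Fin (m - ℓ + 1) → ℕ //
          (∀ s t : Fin (m - ℓ + 1), s < t → a t < a s) ∧
          ∀ t : Fin (m - ℓ + 1), a t ≤ n - (ℓ + t.val)} =>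
        L₀.foldr (fun i Q => D i Q)
          (∏ t : Fin (m - ℓ + 1),
            X (⟨ℓ - 1 + t.val, by have := t.isLt; omega⟩ : Fin n) ^ a.val t)) ∧
    ∀ P : MvPolynomial (Fin n) K,
      (P ∈ Submodule.span (↥(intervalInv K n ℓ))
        (Set.range (fun a : {a : Fin (m - ℓ + 1) → ℕ //
            (∀ s t : Fin (m - ℓ + 1), s < t → a t < a s) ∧
            ∀ t : Fin (m - ℓ + 1), a t ≤ n - (ℓ + t.val)} =>
          L₀.foldr (fun i Q => D i Q)
            (∏ t : Fin (m - ℓ + 1),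
              X (⟨ℓ - 1 + t.val, by have := t.isLt; omega⟩ : Fin n) ^ a.val t)))) ↔
      (∀ σ : Equiv.Perm (Fin n),
        (∀ i : Fin n, i.val + 1 < ℓ → σ i = i) →
        (∀ i : Fin n, ((σ i).val < m ↔ i.val < m)) → rename σ P = P) := by
  set k := m - ℓ + 1 with hk
  let e : Fin k ↪ Fin n := ⟨fun t => ⟨ℓ - 1 + t.val, by have := t.isLt; omega⟩, fun a b h => by
    simp only [Fin.mk.injEq] at h
    exact Fin.ext (by omega)⟩
  have he_val : ∀ t, (e t).val = ℓ - 1 + t.val := fun _ => rfl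
  have he_range : ∀ i : Fin n, i ∈ Finset.univ.image e ↔ ℓ ≤ i.val + 1 ∧ i.val < m := by
    intro i
    simp only [Finset.mem_image, Finset.mem_univ, true_and]
    constructor
    · rintro ⟨t, rfl⟩
      have := t.isLt
      rw [he_val]
      omega
    · rintro ⟨h1, h2⟩
      exact ⟨⟨i.val - (ℓ - 1), by omega⟩, Fin.ext (by rw [he_val]; simp only; omega)⟩
  have hL : ∀ i ∈ L₀, ∀ j, j ∉ Finset.univ.image e → adjSwap i j = j := by
    intro i hi j hj
    have := hL₀mem i hi
    rw [he_range] at hj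
    refine Equiv.swap_apply_of_ne_of_ne ?_ ?_ <;>
    · rintro rfl
      simp only at hj
      omega
  obtain ⟨c, hc, hform⟩ := hD.exists_foldr_formula e hL hL₀len hL₀red
  have hΔ := alternant_rev_ne_zero (K := K) e.injective
  set Δ := alternant K e (fun t => k - 1 - t.val)
  set φ : (Fin k → ℕ) → MvPolynomial (Fin n) K := fun b => L₀.foldr D (∏ t, X (e t) ^ b t) with hφ
  set S : Finset (Fin n) := Finset.univ.filter fun i : Fin n => ℓ ≤ i.val + 1 with hS
  have heS : ∀ t, e t ∈ S := fun t =>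
    Finset.mem_filter.2 ⟨Finset.mem_univ _,
      ((he_range _).1 (Finset.mem_image_of_mem _ (Finset.mem_univ t))).1⟩
  have hScard : S.card = n - ℓ + 1 := by
    have : S = Finset.univ.image fun t : Fin (n - ℓ + 1) =>
        (⟨ℓ - 1 + t.val, by have := t.isLt; omega⟩ : Fin n) := by
      ext i
      simp only [hS, Finset.mem_filter, Finset.mem_univ, true_and, Finset.mem_image, Fin.ext_iff]
      constructor
      · intro h
        have := i.isLt
        exact ⟨⟨i.val - (ℓ - 1), by omega⟩, by simp only; omega⟩
      · rintro ⟨t, ht⟩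
        omega
    rw [this, Finset.card_image_of_injective _ fun a b h => Fin.ext (by simpa using h),
      Finset.card_univ, Fintype.card_fin]
  constructor
  · change LinearIndependent _ fun a : {a : Fin k → ℕ // _} => φ a.val
    rw [linearIndependent_iff']
    intro s g hg
    have h1 : ∑ a ∈ s, (g a : MvPolynomial (Fin n) K) * alternant K e a.val = 0 := by
      refine (mul_eq_zero.1 ?_).resolve_left ((C_ne_zero (σ := Fin n)).2 hc)
      rw [← mul_zero Δ, ← hg, Finset.mul_sum, Finset.mul_sum]
      refine Finset.sum_congr rfl fun a _ => ?_
      rw [Algebra.smul_def, mul_left_comm, ← hform]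
      exact mul_left_comm _ _ _
    have hginv : ∀ a, (g a : MvPolynomial (Fin n) K) ∈ symmSubalgebra K S := fun a => by
      rw [hS, ← intervalInv_eq_symmSubalgebra]; exact (g a).2
    have hι := IsFractionRing.injective (MvPolynomial (Fin n) K)
      (FractionRing (MvPolynomial (Fin n) K))
    have h2 := eq_zero_of_sum_det_pow_eq_zero (F := FractionRing (MvPolynomial (Fin n) K))
      (N := n - ℓ + 1) (Nat.succ_ne_zero _)
      (x := fun j => algebraMap (MvPolynomial (Fin n) K) _
        (X (⟨ℓ - 1 + j.val, by have := j.isLt; omega⟩ : Fin n)))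
      (fun a b h => Fin.ext (by simpa using X_injective (hι h))) s (fun a => a.val)
      Subtype.val_injective (fun a i j hij => a.2.1 i j hij)
      (fun a t => by have := a.2.2 t; omega)
      (fun a => algebraMap _ _ (g a : MvPolynomial (Fin n) K))
      (fun v hv => by
        obtain ⟨w, hw, hwe⟩ := exists_perm_apply_eq S e
          (fun t => (⟨ℓ - 1 + (v t).val, by have := (v t).isLt; omega⟩ : Fin n)) e.injective
          (fun a b h => hv (Fin.ext (by simpa using h))) heS
          (fun t => Finset.mem_filter.2 ⟨Finset.mem_univ _, by simp only; omega⟩)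
        have h3 := congrArg (fun p => algebraMap (MvPolynomial (Fin n) K)
          (FractionRing (MvPolynomial (Fin n) K)) (rename w p)) h1
        simp only [map_sum, map_mul, rename_alternant, map_zero] at h3
        rw [← h3]
        refine Finset.sum_congr rfl fun a _ => ?_
        rw [hginv a w hw, alternant, RingHom.map_det]
        congr 2
        ext p q
        simp [hwe])
    intro a ha
    have h3 := h2 a ha
    rw [← map_zero (algebraMap (MvPolynomial (Fin n) K)
      (FractionRing (MvPolynomial (Fin n) K)))] at h3
    exact Subtype.ext (hι h3)
  · intro P
    constructor
    · intro hP σ hσ hσm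
      obtain ⟨τ, hτ⟩ := exists_perm_comp_eq e σ fun t => by
        have h1 := (he_range (e t)).1 (Finset.mem_image_of_mem _ (Finset.mem_univ t))
        have h2 : σ (e t) ∈ Finset.univ.image e := by
          rw [he_range]
          refine ⟨?_, (hσm _).2 h1.2⟩
          by_contra hlt
          have h3 := σ.injective (hσ (σ (e t)) (by omega))
          rw [h3] at hlt
          exact hlt h1.1
        simpa using h2
      refine Submodule.span_induction (p := fun Q _ => rename σ Q = Q) ?_ ?_ ?_ ?_ hP
      · rintro _ ⟨a, rfl⟩
        exact rename_eq_of_mul_alternant e hτ (hform a.val)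
      · exact map_zero _
      · intro x y _ _ hx hy
        rw [map_add, hx, hy]
      · intro g x _ hx
        rw [Algebra.smul_def, map_mul, hx]
        exact congrArg (· * x) (g.2 σ hσ)
    · intro hP
      change P ∈ Submodule.span (intervalInv K n ℓ)
        (Set.range fun a : {a : Fin k → ℕ // _} => φ a.val)
      set M := Submodule.span (intervalInv K n ℓ) (Set.range fun a : {a : Fin k → ℕ //
        (∀ s t : Fin k, s < t → a t < a s) ∧ ∀ t : Fin k, a t ≤ n - (ℓ + t.val)} => φ a.val)
        with hM
      have hφM : ∀ b : Fin k → ℕ, (∀ t, b t ≤ n - ℓ) → φ b ∈ M := by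
        intro b hb
        by_cases hbi : Function.Injective b
        · obtain ⟨τ, hτ⟩ := exists_perm_strictAnti hbi
          have h1 : φ (b ∘ τ) ∈ M := Submodule.subset_span ⟨⟨b ∘ τ, fun s t hst => hτ hst,
            fun t => by
              have := add_val_le_of_strictAnti hτ (fun t => hb (τ t)) t
              omega⟩, rfl⟩
          have h2 : φ (b ∘ τ) = ((Equiv.Perm.sign τ : ℤ) : MvPolynomial (Fin n) K) * φ b := by
            refine mul_left_cancel₀ hΔ ?_
            rw [mul_left_comm]
            simp only [hφ]
            rw [hform, hform, alternant_comp_right, mul_left_comm]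
          rcases Int.units_eq_one_or (Equiv.Perm.sign τ) with h | h
          · rw [h] at h2
            simpa [h2] using h1
          · rw [h] at h2
            simpa [h2] using h1
        · have h1 : φ b = 0 := by
            refine mul_left_cancel₀ hΔ ?_
            simp only [hφ]
            rw [hform, alternant_eq_zero _ hbi, mul_zero, mul_zero]
          rw [h1]
          exact zero_mem M
      set xδ : MvPolynomial (Fin n) K := ∏ t, X (e t) ^ (k - 1 - t.val) with hxδ
      have hφδ : L₀.foldr D xδ = C c := by
        refine mul_left_cancel₀ hΔ ?_
        rw [mul_comm _ (C c)]
        exact hform _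
      have hmem : P * xδ ∈ symmSubalgebra K (S \ Finset.univ.image e) := by
        intro w hw
        have hwm : ∀ i : Fin n, i.val < m → w i = i := fun i hi => hw i fun h => by
          rw [Finset.mem_sdiff, he_range, hS, Finset.mem_filter] at h
          exact h.2 ⟨h.1.2, hi⟩
        rw [map_mul, hP w (fun i hi => hwm i (by omega)) fun i => ?_]
        · congr 1
          rw [hxδ, map_prod]
          refine Finset.prod_congr rfl fun t _ => ?_
          rw [map_pow, rename_X,
            hwm _ ((he_range _).1 (Finset.mem_image_of_mem _ (Finset.mem_univ t))).2]
        · constructor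
          · intro h
            rwa [w.injective (hwm _ h)] at h
          · intro h
            rwa [hwm i h]
      have hfold : L₀.foldr D (P * xδ) ∈ M := by
        refine Submodule.span_induction (p := fun f _ => L₀.foldr D f ∈ M) ?_ ?_ ?_ ?_
          (mem_span_staircase e e.injective heS hmem)
        · rintro _ ⟨b, hb, rfl⟩
          exact hφM b fun t => by have := hb t; omega
        · rw [hD.foldr_zero]
          exact zero_mem M
        · intro x y _ _ hx hy
          rw [hD.foldr_add]
          exact add_mem hx hy
        · intro g x _ hx
          rw [Algebra.smul_def]
          change L₀.foldr D ((g : MvPolynomial (Fin n) K) * x) ∈ M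
          have hg : (g : MvPolynomial (Fin n) K) ∈ intervalInv K n ℓ := by
            rw [intervalInv_eq_symmSubalgebra]; exact g.2
          rw [hD.foldr_mul fun i hi => g.2 _ fun j hj => hL i hi j fun h => hj ?_]
          · exact M.smul_mem (⟨g, hg⟩ : intervalInv K n ℓ) hx
          · obtain ⟨t, -, rfl⟩ := Finset.mem_image.1 h
            exact heS t
      rw [hD.foldr_mul (fun i hi => ?_), hφδ] at hfold
      · have h1 := M.smul_mem (algebraMap K (intervalInv K n ℓ) c⁻¹) hfold
        rw [Algebra.smul_def] at h1
        change C c⁻¹ * (P * C c) ∈ M at h1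
        rwa [mul_left_comm, ← C_mul, inv_mul_cancel₀ hc, C_1, mul_one] at h1
      · have hfix : ∀ j, j ∉ Finset.univ.image e → adjSwap i j = j := hL i hi
        refine hP _ (fun j hj => hfix j fun h => by rw [he_range] at h; omega) fun j => ?_
        have hi' := hL₀mem i hi
        simp only [adjSwap, Equiv.swap_apply_def]
        split_ifs with h1 h2
        · subst h1; simp only; omega
        · subst h2; simp only; omega
        · exact Iff.rfl
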